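/- arXiv:2312.10814 — 2 statements merged into one kernel-verified Lean document; each statement's English description precedes it below -/
import Mathlib

section
/- Let Φ denote the standard normal CDF and logit(p) = log p − log(1−p) for p ∈ (0,1). For any real constants a > 0 and b, the function g(t) = logit(Φ(a√t + b)) is differentiable for sufficiently large t > 0 and its derivative satisfies lim_{t→∞} g′(t) = a²/2. (This is Theorem 1(b) of the paper for a one-sided hypothesis with θ inside the interval, i.e. δ_L = −∞.) -/
open Filter Real

/-- The standard normal CDF: Φ(x) = ∫_{−∞}^{x} e^{−t²/2}/√(2π) dt. -/
noncomputable def stdNormCDF (x : ℝ) : ℝ :=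
  ∫ t in Set.Iic x, Real.exp (-t ^ 2 / 2) / Real.sqrt (2 * Real.pi)

/-- logit(p) = log p − log(1−p). -/
noncomputable def logit (p : ℝ) : ℝ := Real.log p - Real.log (1 - p)

/-- The standard normal density. -/
noncomputable def stdNormPDF (x : ℝ) : ℝ :=
  Real.exp (-x ^ 2 / 2) / Real.sqrt (2 * Real.pi)

theorem stdNormPDF_pos (x : ℝ) : 0 < stdNormPDF x := by
  unfold stdNormPDF
  positivity

theorem stdNormPDF_eq_gaussianPDFReal :
    stdNormPDF = ProbabilityTheory.gaussianPDFReal 0 1 := by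
  ext x
  simp [stdNormPDF, ProbabilityTheory.gaussianPDFReal, div_eq_inv_mul]

theorem continuous_stdNormPDF : Continuous stdNormPDF := by
  unfold stdNormPDF
  fun_prop

theorem integrable_stdNormPDF : MeasureTheory.Integrable stdNormPDF := by
  rw [stdNormPDF_eq_gaussianPDFReal]
  exact ProbabilityTheory.integrable_gaussianPDFReal 0 1

theorem integral_stdNormPDF : ∫ x, stdNormPDF x = 1 := by
  rw [stdNormPDF_eq_gaussianPDFReal]
  exact ProbabilityTheory.integral_gaussianPDFReal_eq_one 0 one_ne_zero

theorem hasDerivAt_stdNormPDF (x : ℝ) : HasDerivAt stdNormPDF (-x * stdNormPDF x) x := by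
  have h : HasDerivAt (fun y : ℝ => -y ^ 2 / 2) (-x) x := by
    refine ((hasDerivAt_pow 2 x).fun_neg.div_const 2).congr_deriv ?_
    norm_num
    ring
  refine (h.exp.div_const (Real.sqrt (2 * Real.pi))).congr_deriv ?_
  unfold stdNormPDF
  ring

theorem tendsto_stdNormPDF_atTop : Tendsto stdNormPDF atTop (nhds 0) := by
  have h : Tendsto (fun x : ℝ => -x ^ 2 / 2) atTop atBot := by
    have h2 : Tendsto (fun x : ℝ => x ^ 2 / 2) atTop atTop :=
      (tendsto_pow_atTop two_ne_zero).atTop_div_const two_pos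
    simp only [neg_div]
    exact tendsto_neg_atTop_atBot.comp h2
  rw [← zero_div (Real.sqrt (2 * Real.pi))]
  exact (Real.tendsto_exp_atBot.comp h).div_const (Real.sqrt (2 * Real.pi))

theorem hasDerivAt_stdNormCDF (x : ℝ) : HasDerivAt stdNormCDF (stdNormPDF x) x := by
  have h : stdNormCDF = fun y => stdNormCDF 0 + ∫ t in (0 : ℝ)..y, stdNormPDF t := by
    ext y
    have h2 := intervalIntegral.integral_Iic_sub_Iic (a := 0) (b := y)
      integrable_stdNormPDF.integrableOn integrable_stdNormPDF.integrableOn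
    rw [← h2]
    exact (add_sub_cancel _ _).symm
  rw [h]
  exact (continuous_stdNormPDF.integral_hasStrictDerivAt 0 x).hasDerivAt.const_add _

theorem tendsto_stdNormCDF_atTop : Tendsto stdNormCDF atTop (nhds 1) := by
  rw [← integral_stdNormPDF]
  exact (MeasureTheory.aecover_Iic tendsto_id).integral_tendsto_of_countably_generated
    integrable_stdNormPDF

theorem strictMono_stdNormCDF : StrictMono stdNormCDF :=
  strictMono_of_deriv_pos fun x => by
    rw [(hasDerivAt_stdNormCDF x).deriv]
    exact stdNormPDF_pos x

theorem stdNormCDF_lt_one (x : ℝ) : stdNormCDF x < 1 :=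
  (strictMono_stdNormCDF (lt_add_one x)).trans_le
    (strictMono_stdNormCDF.monotone.ge_of_tendsto tendsto_stdNormCDF_atTop _)

/-- The asymptotics of the Mills ratio of the standard normal distribution. -/
theorem tendsto_stdNormPDF_div_mul_one_sub_stdNormCDF :
    Tendsto (fun x => stdNormPDF x / x / (1 - stdNormCDF x)) atTop (nhds 1) := by
  refine HasDerivAt.lhopital_zero_atTop_on_Ioi (a := 0)
    (f' := fun x => (-x * stdNormPDF x * x - stdNormPDF x * 1) / x ^ 2)
    (g' := fun x => -stdNormPDF x) ?_ ?_ ?_ ?_ ?_ ?_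
  · intro x hx
    exact (hasDerivAt_stdNormPDF x).div (hasDerivAt_id x) (ne_of_gt hx)
  · intro x _
    exact (hasDerivAt_stdNormCDF x).const_sub 1
  · intro x _
    exact neg_ne_zero.mpr (stdNormPDF_pos x).ne'
  · exact tendsto_stdNormPDF_atTop.div_atTop tendsto_id
  · simpa using tendsto_stdNormCDF_atTop.const_sub 1
  · have h : Tendsto (fun x : ℝ => 1 + (x ^ 2)⁻¹) atTop (nhds 1) := by
      simpa using (tendsto_inv_atTop_zero.comp
        (tendsto_pow_atTop (α := ℝ) two_ne_zero)).const_add 1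
    refine h.congr' ?_
    filter_upwards [eventually_gt_atTop 0] with x hx
    have := (stdNormPDF_pos x).ne'
    field_simp
    ring

theorem hasDerivAt_logit {p : ℝ} (h0 : 0 < p) (h1 : p < 1) :
    HasDerivAt logit (1 / (p * (1 - p))) p := by
  have h2 : 1 - p ≠ 0 := (sub_pos.mpr h1).ne'
  refine ((Real.hasDerivAt_log h0.ne').sub
    (((hasDerivAt_id p).const_sub 1).log h2)).congr_deriv ?_
  simp only [id]
  field_simp
  ring

/-- For a > 0 and b real, g(t) = logit(Φ(a√t + b)) is differentiable for
sufficiently large t > 0 and lim_{t→∞} g′(t) = a²/2. -/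
theorem stmt5 (a b : ℝ) (ha : 0 < a) :
    (∀ᶠ t : ℝ in atTop,
        DifferentiableAt ℝ (fun t : ℝ => logit (stdNormCDF (a * Real.sqrt t + b))) t) ∧
      Tendsto (deriv fun t : ℝ => logit (stdNormCDF (a * Real.sqrt t + b)))
        atTop (nhds (a ^ 2 / 2)) := by
  have hx : Tendsto (fun t : ℝ => a * Real.sqrt t + b) atTop atTop :=
    tendsto_atTop_add_const_right _ _ (Real.tendsto_sqrt_atTop.const_mul_atTop ha)
  have hcdf := tendsto_stdNormCDF_atTop.comp hx
  have hpos := hcdf.eventually (lt_mem_nhds one_pos)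
  have hderiv : ∀ᶠ t : ℝ in atTop,
      HasDerivAt (fun t : ℝ => logit (stdNormCDF (a * Real.sqrt t + b)))
        (1 / (stdNormCDF (a * Real.sqrt t + b) * (1 - stdNormCDF (a * Real.sqrt t + b))) *
          (stdNormPDF (a * Real.sqrt t + b) * (a * (1 / (2 * Real.sqrt t))))) t := by
    filter_upwards [eventually_gt_atTop 0, hpos] with t ht hp
    have hlin : HasDerivAt (fun t : ℝ => a * Real.sqrt t + b) (a * (1 / (2 * Real.sqrt t))) t :=
      ((Real.hasDerivAt_sqrt ht.ne').const_mul a).add_const b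
    exact (hasDerivAt_logit hp (stdNormCDF_lt_one _)).comp t
      ((hasDerivAt_stdNormCDF (a * Real.sqrt t + b)).comp t hlin)
  refine ⟨hderiv.mono fun t ht => ht.differentiableAt, ?_⟩
  have hratio : Tendsto (fun t : ℝ => a + b / Real.sqrt t) atTop (nhds a) := by
    simpa using (Real.tendsto_sqrt_atTop.const_div_atTop b).const_add a
  have hlim := (((tendsto_stdNormPDF_div_mul_one_sub_stdNormCDF.comp hx).mul
    (hcdf.inv₀ one_ne_zero)).mul hratio).mul_const (a / 2)
  have hval : 1 * (1 : ℝ)⁻¹ * a * (a / 2) = a ^ 2 / 2 := by ring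
  rw [hval] at hlim
  refine hlim.congr' ?_
  filter_upwards [hderiv, eventually_gt_atTop 0, hpos, hx.eventually_gt_atTop 0]
    with t hd ht hp hxt
  rw [hd.deriv]
  have hs : Real.sqrt t ≠ 0 := (Real.sqrt_pos.mpr ht).ne'
  have hq : 1 - stdNormCDF (a * Real.sqrt t + b) ≠ 0 :=
    (sub_pos.mpr (stdNormCDF_lt_one _)).ne'
  have hp' : stdNormCDF (a * Real.sqrt t + b) ≠ 0 := hp.ne'
  have hab : a + b / Real.sqrt t = (a * Real.sqrt t + b) / Real.sqrt t := by
    field_simp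
  simp only [Function.comp_apply, hab]
  have hxt' := hxt.ne'
  generalize a * Real.sqrt t + b = x at *
  field_simp
end

section
/- Let Φ denote the standard normal CDF and let a_L < 0 < a_U and b be real constants. Define f(t) = Φ(a_U√t + b) − Φ(a_L√t + b) for t > 0. Then lim_{t→∞} (1/t)·log(1 − f(t)) = −min{a_U², a_L²}/2. -/
open Filter Real

open MeasureTheory

lemma integrable_stdNorm_density :
    Integrable fun t : ℝ => Real.exp (-t ^ 2 / 2) / Real.sqrt (2 * Real.pi) := by
  have h := (integrable_exp_neg_mul_sq (b := 1 / 2) (by norm_num)).div_const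
    (Real.sqrt (2 * Real.pi))
  refine h.congr (ae_of_all _ fun t => ?_)
  simp only
  ring_nf

lemma integral_stdNorm_density :
    ∫ t : ℝ, Real.exp (-t ^ 2 / 2) / Real.sqrt (2 * Real.pi) = 1 := by
  have h := integral_gaussian (1 / 2)
  rw [integral_div, div_eq_one_iff_eq (by positivity)]
  calc _ = ∫ t : ℝ, Real.exp (-(1 / 2) * t ^ 2) := by
        congr 1; ext t; ring_nf
    _ = _ := by rw [h]; congr 1; ring

lemma one_sub_stdNormCDF (x : ℝ) : 1 - stdNormCDF x = stdNormCDF (-x) := by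
  have h := integral_add_compl (measurableSet_Iic (a := x)) integrable_stdNorm_density
  rw [integral_stdNorm_density, Set.compl_Iic] at h
  have h2 := integral_comp_neg_Iic (-x)
    (fun t : ℝ => Real.exp (-t ^ 2 / 2) / Real.sqrt (2 * Real.pi))
  simp only [neg_sq, neg_neg] at h2
  unfold stdNormCDF
  linarith

lemma stdNormCDF_neg_le {x : ℝ} (hx : 0 ≤ x) :
    stdNormCDF (-x) ≤ Real.exp (-x ^ 2 / 2) := by
  set φ := fun t : ℝ => Real.exp (-t ^ 2 / 2) / Real.sqrt (2 * Real.pi) with hφ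
  have hint : Integrable φ := integrable_stdNorm_density
  have hshift : stdNormCDF (-x) = ∫ u in Set.Iic (0 : ℝ), φ (u - x) := by
    have h := (measurePreserving_sub_right volume x).setIntegral_preimage_emb
      (MeasurableEquiv.subRight x).measurableEmbedding φ (Set.Iic (-x))
    rw [Set.preimage_sub_const_Iic, neg_add_cancel] at h
    exact h.symm
  calc stdNormCDF (-x) = ∫ u in Set.Iic (0 : ℝ), φ (u - x) := hshift
    _ ≤ ∫ u in Set.Iic (0 : ℝ), Real.exp (-x ^ 2 / 2) * φ u := by
        refine setIntegral_mono_on (hint.comp_sub_right x).integrableOn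
          (hint.const_mul _).integrableOn measurableSet_Iic fun u hu => ?_
        simp only [hφ]
        rw [← mul_div_assoc, ← Real.exp_add]
        gcongr
        nlinarith [mul_nonneg hx (neg_nonneg.2 (Set.mem_Iic.1 hu))]
    _ ≤ ∫ u, Real.exp (-x ^ 2 / 2) * φ u :=
        setIntegral_le_integral (hint.const_mul _)
          (ae_of_all _ fun u => by simp only [hφ, Pi.zero_apply]; positivity)
    _ = Real.exp (-x ^ 2 / 2) := by
        rw [integral_const_mul, hφ, integral_stdNorm_density, mul_one]

lemma le_stdNormCDF_neg {x : ℝ} (hx : 0 ≤ x) :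
    Real.exp (-(x + 1) ^ 2 / 2) / Real.sqrt (2 * Real.pi) ≤ stdNormCDF (-x) := by
  have hint := integrable_stdNorm_density
  calc Real.exp (-(x + 1) ^ 2 / 2) / Real.sqrt (2 * Real.pi)
      = ∫ _ in Set.Icc (-x - 1) (-x),
          Real.exp (-(x + 1) ^ 2 / 2) / Real.sqrt (2 * Real.pi) := by
        simp
    _ ≤ ∫ t in Set.Icc (-x - 1) (-x), Real.exp (-t ^ 2 / 2) / Real.sqrt (2 * Real.pi) := by
        refine setIntegral_mono_on (by simp) hint.integrableOn
          measurableSet_Icc fun t ht => ?_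
        have h : -(x + 1) ^ 2 / 2 ≤ -t ^ 2 / 2 := by nlinarith [ht.1, ht.2]
        gcongr
    _ ≤ stdNormCDF (-x) :=
        setIntegral_mono_set hint.integrableOn (ae_of_all _ fun t => by
          simp only [Pi.zero_apply]; positivity) Set.Icc_subset_Iic_self.eventuallyLE

lemma stdNormCDF_pos (x : ℝ) : 0 < stdNormCDF x := by
  refine (setIntegral_pos_iff_support_of_nonneg_ae (ae_of_all _ fun t => ?_)
    integrable_stdNorm_density.integrableOn).2 ?_
  · simp only [Pi.zero_apply]; positivity
  · rw [Function.support_eq_univ fun t => by positivity]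
    simp

lemma tendsto_inv_mul_sq_sqrt (a c d : ℝ) :
    Tendsto (fun t : ℝ => (1 / t) * (-(a * Real.sqrt t + c) ^ 2 / 2 + d)) atTop
      (nhds (-a ^ 2 / 2)) := by
  have h1 : Tendsto (fun t : ℝ => (Real.sqrt t)⁻¹) atTop (nhds 0) :=
    tendsto_inv_atTop_zero.comp Real.tendsto_sqrt_atTop
  have h := ((h1.const_mul (-(a * c))).add
    ((h1.pow 2).const_mul (d - c ^ 2 / 2))).const_add (-a ^ 2 / 2)
  simp only [ne_eq, OfNat.ofNat_ne_zero, not_false_eq_true, zero_pow, mul_zero, add_zero] at h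
  refine h.congr' ?_
  filter_upwards [eventually_gt_atTop 0] with t ht
  have hs := Real.sqrt_pos.2 ht
  obtain ⟨s, hs', rfl⟩ : ∃ s : ℝ, 0 < s ∧ t = s ^ 2 := ⟨√t, hs, (Real.sq_sqrt ht.le).symm⟩
  rw [Real.sqrt_sq hs'.le]
  field_simp
  ring

lemma tendsto_inv_mul_log_stdNormCDF {a : ℝ} (ha : 0 < a) (c : ℝ) :
    Tendsto (fun t : ℝ => (1 / t) * Real.log (stdNormCDF (-(a * Real.sqrt t + c)))) atTop
      (nhds (-a ^ 2 / 2)) := by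
  have hx : ∀ᶠ t : ℝ in atTop, 0 ≤ a * Real.sqrt t + c :=
    (tendsto_atTop_add_const_right _ c
      (Real.tendsto_sqrt_atTop.const_mul_atTop ha)).eventually_ge_atTop 0
  refine tendsto_of_tendsto_of_tendsto_of_le_of_le'
    (tendsto_inv_mul_sq_sqrt a (c + 1) (-Real.log (Real.sqrt (2 * Real.pi))))
    (tendsto_inv_mul_sq_sqrt a c 0) ?_ ?_
  · filter_upwards [hx, eventually_gt_atTop 0] with t h ht
    have := Real.log_le_log (by positivity) (le_stdNormCDF_neg h)
    rw [Real.log_div (by positivity) (by positivity), Real.log_exp, add_assoc] at this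
    gcongr
    linarith
  · filter_upwards [hx, eventually_gt_atTop 0] with t h ht
    have := Real.log_le_log (stdNormCDF_pos _) (stdNormCDF_neg_le h)
    rw [Real.log_exp] at this
    gcongr
    linarith

/-- The exponential rate of a sum of two positive functions is the larger of their rates. -/
lemma tendsto_inv_mul_log_add {P R : ℝ → ℝ} {p r : ℝ} (hP : ∀ t, 0 < P t) (hR : ∀ t, 0 < R t)
    (hp : Tendsto (fun t : ℝ => (1 / t) * Real.log (P t)) atTop (nhds p))
    (hr : Tendsto (fun t : ℝ => (1 / t) * Real.log (R t)) atTop (nhds r)) :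
    Tendsto (fun t : ℝ => (1 / t) * Real.log (P t + R t)) atTop (nhds (max p r)) := by
  have hu : Tendsto (fun t : ℝ => Real.log 2 * t⁻¹ +
      max ((1 / t) * Real.log (P t)) ((1 / t) * Real.log (R t))) atTop (nhds (max p r)) := by
    simpa using (tendsto_inv_atTop_zero.const_mul (Real.log 2)).add (hp.max hr)
  refine tendsto_of_tendsto_of_tendsto_of_le_of_le' (hp.max hr) hu ?_ ?_
  · filter_upwards [eventually_gt_atTop 0] with t ht
    refine max_le ?_ ?_
    · gcongr
      · exact hP t
      · linarith [hR t]
    · gcongr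
      · exact hR t
      · linarith [hP t]
  · filter_upwards [eventually_gt_atTop 0] with t ht
    rw [← mul_max_of_nonneg _ _ (by positivity : 0 ≤ 1 / t), ← one_div, mul_comm (Real.log 2),
      ← mul_add]
    have hPt := hP t
    have hRt := hR t
    refine mul_le_mul_of_nonneg_left ?_ (by positivity)
    rcases le_total (P t) (R t) with h | h
    · calc _ ≤ Real.log (2 * R t) := Real.log_le_log (by positivity) (by linarith)
        _ = Real.log 2 + Real.log (R t) := Real.log_mul two_ne_zero hRt.ne'
        _ ≤ _ := by gcongr; exact le_max_right _ _
    · calc _ ≤ Real.log (2 * P t) := Real.log_le_log (by positivity) (by linarith)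
        _ = Real.log 2 + Real.log (P t) := Real.log_mul two_ne_zero hPt.ne'
        _ ≤ _ := by gcongr; exact le_max_left _ _

/-- For a_L < 0 < a_U and f(t) = Φ(a_U√t + b) − Φ(a_L√t + b),
lim_{t→∞} (1/t)·log(1 − f(t)) = −min{a_U², a_L²}/2. -/
theorem stmt12 (aL aU b : ℝ) (haL : aL < 0) (haU : 0 < aU) :
    Tendsto (fun t : ℝ =>
        (1 / t) * Real.log
          (1 - (stdNormCDF (aU * Real.sqrt t + b) - stdNormCDF (aL * Real.sqrt t + b))))
      atTop (nhds (-min (aU ^ 2) (aL ^ 2) / 2)) := by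
  have h := tendsto_inv_mul_log_add (fun _ => stdNormCDF_pos _) (fun _ => stdNormCDF_pos _)
    (tendsto_inv_mul_log_stdNormCDF haU b)
    (tendsto_inv_mul_log_stdNormCDF (neg_pos.2 haL) (-b))
  have hlim : max (-aU ^ 2 / 2) (-(-aL) ^ 2 / 2) = -min (aU ^ 2) (aL ^ 2) / 2 := by
    rw [max_div_div_right zero_le_two, max_neg_neg, neg_sq]
  rw [hlim] at h
  refine h.congr fun t => ?_
  rw [← one_sub_stdNormCDF (aU * Real.sqrt t + b),
    show -(-aL * Real.sqrt t + -b) = aL * Real.sqrt t + b by ring]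
  congr 2
  ring
end
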